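/- (Completeness of the compilation.) If a plan π solves both the robot's problem P_R and the human's problem P_H, then π solves the compiled problem P_mod (i.e., π is executable from I_mod in P_mod and its resulting state contains G_mod). -/

import Mathlib

/-- A STRIPS planning problem over fluents `F` and actions `A`. -/
structure Problem (F : Type) (A : Type) where
  pre : A → Set F
  add : A → Set F
  del : A → Set F
  I : Set F
  G : Set F

/-- Applying action `a` in state `s`. -/
def applyAct {F A : Type} (P : Problem F A) (s : Set F) (a : A) : Set F :=
  (s ∪ P.add a) \ P.del a

/-- A plan is executable from a state iff each action's precondition holds
in the state obtained by applying the preceding actions. -/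
def Executable {F A : Type} (P : Problem F A) : Set F → List A → Prop
  | _, [] => True
  | s, a :: rest => P.pre a ⊆ s ∧ Executable P (applyAct P s a) rest

/-- The resulting state of a plan from a state. -/
def result {F A : Type} (P : Problem F A) : Set F → List A → Set F
  | s, [] => s
  | s, a :: rest => result P (applyAct P s a) rest

/-- A plan solves a problem iff it is executable from the initial state and
its resulting state contains the goal. -/
def Solves {F A : Type} (P : Problem F A) (π : List A) : Prop :=
  Executable P P.I π ∧ P.G ⊆ result P P.I π

/-- Tagged union of two states: `s_R ⊎ s_H ⊆ F ⊕ F`. -/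
def tagUnion {F : Type} (sR sH : Set F) : Set (F ⊕ F) :=
  Sum.inl '' sR ∪ Sum.inr '' sH

/-- The compiled problem `P_mod` over `F ⊕ F`. -/
def compiled {F A : Type} (PR PH : Problem F A) : Problem (F ⊕ F) A where
  pre a := tagUnion (PR.pre a) (PH.pre a)
  add a := tagUnion (PR.add a) (PH.add a)
  del a := tagUnion (PR.del a) (PH.del a)
  I := tagUnion PR.I PH.I
  G := tagUnion PR.G PH.G

theorem tagUnion_mono_aux {F : Type} {a b c d : Set F} (h1 : a ⊆ c) (h2 : b ⊆ d) :
    tagUnion a b ⊆ tagUnion c d :=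
  Set.union_subset_union (Set.image_mono h1) (Set.image_mono h2)

theorem applyAct_compiled_aux {F A : Type} (PR PH : Problem F A) (sR sH : Set F) (a : A) :
    applyAct (compiled PR PH) (tagUnion sR sH) a
      = tagUnion (applyAct PR sR a) (applyAct PH sH a) := by
  ext x
  cases x <;> simp [applyAct, compiled, tagUnion]

theorem compiled_run_aux {F A : Type} (PR PH : Problem F A) (π : List A) :
    ∀ sR sH : Set F, Executable PR sR π → Executable PH sH π →
      Executable (compiled PR PH) (tagUnion sR sH) π ∧
      result (compiled PR PH) (tagUnion sR sH) π
        = tagUnion (result PR sR π) (result PH sH π) := by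
  induction π with
  | nil => intro sR sH _ _; exact ⟨trivial, rfl⟩
  | cons a rest ih =>
    intro sR sH h1 h2
    have h := ih _ _ h1.2 h2.2
    rw [← applyAct_compiled_aux] at h
    exact ⟨⟨tagUnion_mono_aux h1.1 h2.1, h.1⟩, h.2⟩

theorem stmt_4 {F A : Type} (PR PH : Problem F A) (π : List A)
    (hR : Solves PR π) (hH : Solves PH π) : Solves (compiled PR PH) π := by
  have h := compiled_run_aux PR PH π PR.I PH.I hR.1 hH.1
  refine ⟨h.1, ?_⟩
  change tagUnion PR.G PH.G ⊆ result (compiled PR PH) (tagUnion PR.I PH.I) π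
  rw [h.2]
  exact tagUnion_mono_aux hR.2 hH.2
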